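/- Let X be a real locally convex Hausdorff topological vector space and let Ω₁, Ω₂ be nonempty convex subsets of X. Suppose one of the following holds: (a) Ω₁ ∩ int Ω₂ ≠ ∅; (b) Ω₁ and Ω₂ are polyhedral convex sets and Ω₁ ∩ Ω₂ ≠ ∅; (c) X is a Banach space, Ω₁ and Ω₂ are closed, and 0 ∈ sqri(Ω₁ − Ω₂). Then σ_{Ω₁∩Ω₂} = σ_{Ω₁} □ σ_{Ω₂} on X*, and for every x* ∈ X* with σ_{Ω₁∩Ω₂}(x*) ∈ ℝ there exist x₁*, x₂* ∈ X* with x* = x₁* + x₂* and σ_{Ω₁∩Ω₂}(x*) = σ_{Ω₁}(x₁*) + σ_{Ω₂}(x₂*). -/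

import Mathlib

open Pointwise

noncomputable section

variable {X : Type*} [NormedAddCommGroup X] [NormedSpace ℝ X]

/-- Support function of `Ω ⊆ X`, with values in `ℝ ∪ {±∞}`. -/
def suppFn (Ω : Set X) (xs : X →L[ℝ] ℝ) : EReal :=
  sSup ((fun x => ((xs x : ℝ) : EReal)) '' Ω)

/-- A polyhedral convex set: a finite intersection of half-spaces determined by
continuous linear functionals. -/
def IsPolyhedral (Ω : Set X) : Prop :=
  ∃ (m : ℕ) (a : Fin m → (X →L[ℝ] ℝ)) (b : Fin m → ℝ), Ω = {x | ∀ i, a i x ≤ b i}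

/-- The cone generated by a set: `cone A = {t • a | t ≥ 0, a ∈ A}`. -/
def coneGen (A : Set X) : Set X := {x | ∃ t : ℝ, 0 ≤ t ∧ ∃ a ∈ A, x = t • a}

/-- `0 ∈ sqri A`: `0 ∈ A` and the cone generated by `A` is a closed linear subspace. -/
def ZeroSqri (A : Set X) : Prop :=
  (0 : X) ∈ A ∧ ∃ S : Submodule ℝ X, (S : Set X) = coneGen A ∧ IsClosed (S : Set X)

/-- A closed convex set whose positive multiples cover a Banach space is a neighborhood of `0`. -/
theorem mem_nhds_zero_of_forall_exists_smul_mem {F : Type*} [NormedAddCommGroup F]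
    [NormedSpace ℝ F] [CompleteSpace F] {D : Set F} (hcl : IsClosed D) (hcv : Convex ℝ D)
    (habs : ∀ s : F, ∃ t : ℝ, 0 < t ∧ t • s ∈ D) : D ∈ nhds (0 : F) := by
  have h0 : (0 : F) ∈ D := by
    obtain ⟨t, -, h⟩ := habs 0
    simpa using h
  have hcover : ⋃ n : ℕ, (fun s : F => ((n : ℝ) + 1)⁻¹ • s) ⁻¹' D = Set.univ := by
    refine Set.eq_univ_of_forall fun s => ?_
    obtain ⟨t, ht, hs⟩ := habs s
    obtain ⟨n, hn⟩ := exists_nat_one_div_lt ht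
    rw [one_div] at hn
    have hn0 : (0 : ℝ) < ((n : ℝ) + 1)⁻¹ := by positivity
    refine Set.mem_iUnion.2 ⟨n, ?_⟩
    have := hcv.smul_mem_of_zero_mem h0 hs (t := ((n : ℝ) + 1)⁻¹ / t)
      ⟨by positivity, (div_le_one ht).2 hn.le⟩
    rwa [smul_smul, div_mul_cancel₀ _ ht.ne'] at this
  obtain ⟨n, x, hx⟩ := nonempty_interior_of_iUnion_of_closed
    (fun n : ℕ => hcl.preimage (continuous_const_smul (((n : ℝ) + 1)⁻¹))) hcover
  have hn0 : ((n : ℝ) + 1)⁻¹ ≠ 0 := by positivity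
  have hw : ((n : ℝ) + 1)⁻¹ • x ∈ interior D :=
    (isOpenMap_smul₀ hn0).interior_preimage_subset_preimage_interior hx
  generalize ((n : ℝ) + 1)⁻¹ • x = w at hw
  obtain ⟨t, ht, hs⟩ := habs (-w)
  have := hcv.combo_interior_self_mem_interior hw hs
    (a := t / (1 + t)) (b := 1 / (1 + t)) (by positivity) (by positivity) (by field_simp; ring)
  rw [← mem_interior_iff_mem_nhds]
  convert this using 1
  rw [smul_smul, smul_neg, ← sub_eq_add_neg, ← sub_smul]
  rw [one_div, inv_mul_eq_div, sub_self, zero_smul]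

/-- If the closure of the image of a bounded closed convex set under a continuous linear map
contains a ball around `0`, then the image itself contains the ball of half the radius. -/
theorem ball_half_subset_image_of_ball_subset_closure_image {E F : Type*}
    [NormedAddCommGroup E] [NormedSpace ℝ E] [CompleteSpace E]
    [NormedAddCommGroup F] [NormedSpace ℝ F] (L : E →L[ℝ] F) {K : Set E}
    (hcl : IsClosed K) (hcv : Convex ℝ K) {R : ℝ} (hR : ∀ k ∈ K, ‖k‖ ≤ R) {ρ : ℝ} (hρ : 0 < ρ)
    (hball : Metric.ball 0 ρ ⊆ closure (L '' K)) : Metric.ball 0 (ρ / 2) ⊆ L '' K := by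
  intro z hz
  have hstep : ∀ u : Metric.ball (0 : F) ρ, ∃ k ∈ K, ‖(u : F) - L k‖ < ρ / 2 := by
    intro u
    obtain ⟨-, ⟨k, hk, rfl⟩, hd⟩ := Metric.mem_closure_iff.1 (hball u.2) (ρ / 2) (by positivity)
    exact ⟨k, hk, by rwa [← dist_eq_norm]⟩
  choose k hkK hkd using hstep
  let next : Metric.ball (0 : F) ρ → Metric.ball (0 : F) ρ := fun u =>
    ⟨(2 : ℝ) • ((u : F) - L (k u)), by
      rw [mem_ball_zero_iff, norm_smul, Real.norm_ofNat]
      linarith [hkd u]⟩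
  have hz2 : (2 : ℝ) • z ∈ Metric.ball (0 : F) ρ := by
    rw [mem_ball_zero_iff] at hz ⊢
    rw [norm_smul, Real.norm_ofNat]
    linarith
  let u : ℕ → Metric.ball (0 : F) ρ := fun n => next^[n] ⟨(2 : ℝ) • z, hz2⟩
  have hu : ∀ n, ((u (n + 1) : F)) = (2 : ℝ) • ((u n : F) - L (k (u n))) := fun n => by
    simp only [u, Function.iterate_succ_apply', next]
  let s : ℕ → E := fun n => ∑ i ∈ Finset.range n, (1 / 2 : ℝ) ^ (i + 1) • k (u i)
  have hs : ∀ n, s (n + 1) = s n + (1 / 2 : ℝ) ^ (n + 1) • k (u n) :=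
    fun n => Finset.sum_range_succ _ _
  have hrem : ∀ n, z - L (s n) = (1 / 2 : ℝ) ^ (n + 1) • (u n : F) := by
    intro n
    induction n with
    | zero => simp [s, u, smul_smul]
    | succ n ih =>
      rw [hs, hu, map_add, map_smul, ← sub_sub, ih, smul_smul, ← smul_sub]
      congr 1
      ring
  have hmem : ∀ n, ∀ y ∈ K, s n + (1 / 2 : ℝ) ^ n • y ∈ K := by
    intro n
    induction n with
    | zero => intro y hy; simpa [s] using hy
    | succ n ih =>
      intro y hy
      convert ih _ (hcv (hkK (u n)) hy (a := 1 / 2) (b := 1 / 2) (by norm_num) (by norm_num)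
        (by norm_num)) using 1
      rw [hs, smul_add, smul_smul, smul_smul, ← pow_succ, add_assoc]
  have hcauchy : CauchySeq s := by
    refine cauchySeq_of_le_geometric_two (C := R) fun n => ?_
    rw [dist_comm, dist_eq_norm, hs, add_sub_cancel_left, norm_smul, norm_pow]
    have := hR _ (hkK (u n))
    calc _ ≤ ‖(1 / 2 : ℝ)‖ ^ (n + 1) * R := by gcongr
      _ = R / 2 / 2 ^ n := by
        rw [Real.norm_of_nonneg (by norm_num), one_div, inv_pow, pow_succ]
        field_simp
  obtain ⟨l, hl⟩ := cauchySeq_tendsto_of_complete hcauchy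
  have hpow : Filter.Tendsto (fun n : ℕ => (1 / 2 : ℝ) ^ n) Filter.atTop (nhds 0) :=
    tendsto_pow_atTop_nhds_zero_of_lt_one (by norm_num) (by norm_num)
  refine ⟨l, hcl.mem_of_tendsto (f := fun n => s n + (1 / 2 : ℝ) ^ n • k (u 0))
    (b := Filter.atTop) ?_ (Filter.Eventually.of_forall fun n => hmem n _ (hkK _)), ?_⟩
  · simpa using hl.add (hpow.smul_const (k (u 0)))
  · have h1 : Filter.Tendsto (fun n => z - L (s n)) Filter.atTop (nhds (z - L l)) :=
      tendsto_const_nhds.sub ((L.continuous.tendsto l).comp hl)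
    have h2 : Filter.Tendsto (fun n => z - L (s n)) Filter.atTop (nhds 0) := by
      have h3 : Filter.Tendsto (fun n : ℕ => (1 / 2 : ℝ) ^ (n + 1) * ρ) Filter.atTop (nhds 0) := by
        simpa using ((Filter.tendsto_add_atTop_iff_nat 1).2 hpow).mul_const ρ
      refine squeeze_zero_norm (fun n => ?_) h3
      rw [hrem, norm_smul, norm_pow, Real.norm_of_nonneg (by norm_num : (0 : ℝ) ≤ 1 / 2)]
      gcongr
      exact (mem_ball_zero_iff.1 (u n).2).le
    exact (sub_eq_zero.1 (tendsto_nhds_unique h1 h2)).symm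

/-- The image of a bounded closed convex set under a continuous linear map between Banach spaces
is a neighborhood of `0` as soon as it absorbs every point. -/
theorem image_mem_nhds_zero_of_forall_exists_smul_mem {E F : Type*}
    [NormedAddCommGroup E] [NormedSpace ℝ E] [CompleteSpace E]
    [NormedAddCommGroup F] [NormedSpace ℝ F] [CompleteSpace F] (L : E →L[ℝ] F) {K : Set E}
    (hcl : IsClosed K) (hcv : Convex ℝ K) {R : ℝ} (hR : ∀ k ∈ K, ‖k‖ ≤ R)
    (habs : ∀ s : F, ∃ t : ℝ, 0 < t ∧ t • s ∈ L '' K) : L '' K ∈ nhds (0 : F) := by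
  have hcl' : closure (L '' K) ∈ nhds (0 : F) :=
    mem_nhds_zero_of_forall_exists_smul_mem isClosed_closure
      (hcv.linear_image L.toLinearMap).closure fun s =>
        (habs s).imp fun t ht => ⟨ht.1, subset_closure ht.2⟩
  obtain ⟨ρ, hρ, hball⟩ := Metric.mem_nhds_iff.1 hcl'
  exact Filter.mem_of_superset (Metric.ball_mem_nhds 0 (half_pos hρ))
    (ball_half_subset_image_of_ball_subset_closure_image L hcl hcv hR hρ hball)

/-- **Farkas' lemma** for linear functionals on an arbitrary real vector space. -/
theorem exists_nonneg_sum_smul_of_forall_nonpos {V : Type*} [AddCommGroup V] [Module ℝ V]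
    {m : ℕ} (a : Fin m → V →ₗ[ℝ] ℝ) (f : V →ₗ[ℝ] ℝ)
    (h : ∀ v, (∀ i, a i v ≤ 0) → f v ≤ 0) :
    ∃ c : Fin m → ℝ, (∀ i, 0 ≤ c i) ∧ ∀ v, f v = ∑ i, c i * a i v := by
  induction m generalizing f with
  | zero =>
    refine ⟨fun _ => 0, fun i => i.elim0, fun v => ?_⟩
    have h1 := h v (fun i => i.elim0)
    have h2 := h (-v) (fun i => i.elim0)
    rw [map_neg] at h2
    simp only [Finset.univ_eq_empty, Finset.sum_empty]
    linarith
  | succ m ih =>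
    by_cases hcase : ∀ v, (∀ i : Fin m, a i.succ v ≤ 0) → f v ≤ 0
    · obtain ⟨c, hc, hf⟩ := ih (fun i => a i.succ) f hcase
      refine ⟨Fin.cons 0 c, Fin.cases le_rfl hc, fun v => ?_⟩
      simp [Fin.sum_univ_succ, hf v]
    · push Not at hcase
      obtain ⟨v, hv, hfv⟩ := hcase
      have ha : 0 < a 0 v := by
        by_contra! hneg
        exact absurd (h v (Fin.cases hneg hv)) hfv.not_ge
      let P : V →ₗ[ℝ] V := LinearMap.id - (a 0).smulRight ((a 0 v)⁻¹ • v)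
      have hP : ∀ g : V →ₗ[ℝ] ℝ, ∀ w, g (P w) = g w - a 0 w * ((a 0 v)⁻¹ * g v) :=
        fun g w => by simp [P]
      obtain ⟨c, hc, hf⟩ := ih (fun i => a i.succ ∘ₗ P) (f ∘ₗ P) fun w hw =>
        h (P w) (Fin.cases (by rw [hP, inv_mul_cancel₀ ha.ne', mul_one, sub_self]) hw)
      have hc0 : 0 ≤ (a 0 v)⁻¹ * (f v - ∑ i, c i * a i.succ v) := by
        have : ∑ i, c i * a i.succ v ≤ 0 :=
          Finset.sum_nonpos fun i _ => mul_nonpos_of_nonneg_of_nonpos (hc i) (hv i)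
        exact mul_nonneg (by positivity) (by linarith)
      refine ⟨Fin.cons ((a 0 v)⁻¹ * (f v - ∑ i, c i * a i.succ v)) c, Fin.cases hc0 hc,
        fun w => ?_⟩
      · have hw := hf w
        simp only [LinearMap.comp_apply, hP, mul_sub, Finset.sum_sub_distrib] at hw
        have hsum : ∑ i, c i * (a 0 w * ((a 0 v)⁻¹ * a i.succ v)) =
            a 0 w * ((a 0 v)⁻¹ * ∑ i, c i * a i.succ v) := by
          simp only [Finset.mul_sum]
          exact Finset.sum_congr rfl fun i _ => by ring
        rw [hsum] at hw
        simp only [Fin.sum_univ_succ, Fin.cons_zero, Fin.cons_succ]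
        linarith

/-- **Affine Farkas lemma**: an affine inequality valid on a nonempty polyhedron follows from a
nonnegative combination of the defining inequalities. -/
theorem exists_nonneg_sum_smul_of_forall_le {V : Type*} [AddCommGroup V] [Module ℝ V]
    {m : ℕ} (a : Fin m → V →ₗ[ℝ] ℝ) (b : Fin m → ℝ) (f : V →ₗ[ℝ] ℝ) (r : ℝ)
    (hne : ∃ v, ∀ i, a i v ≤ b i) (h : ∀ v, (∀ i, a i v ≤ b i) → f v ≤ r) :
    ∃ c : Fin m → ℝ, (∀ i, 0 ≤ c i) ∧ (∀ v, f v = ∑ i, c i * a i v) ∧ ∑ i, c i * b i ≤ r := by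
  obtain ⟨v₀, hv₀⟩ := hne
  let A : Fin (m + 1) → V × ℝ →ₗ[ℝ] ℝ :=
    Fin.cons (-LinearMap.snd ℝ V ℝ)
      fun i => a i ∘ₗ LinearMap.fst ℝ V ℝ - b i • LinearMap.snd ℝ V ℝ
  obtain ⟨c, hc, hf⟩ := exists_nonneg_sum_smul_of_forall_nonpos A
    (f ∘ₗ LinearMap.fst ℝ V ℝ - r • LinearMap.snd ℝ V ℝ) (by
      rintro ⟨v, t⟩ hv
      have ht : 0 ≤ t := by simpa [A] using hv 0
      have hv' : ∀ i, a i v ≤ b i * t := fun i => by simpa [A] using hv i.succ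
      suffices f v ≤ r * t by simpa using this
      rcases ht.eq_or_lt with rfl | ht
      · by_contra! hpos
        rw [mul_zero] at hpos
        have hray : ∀ s : ℝ, 0 ≤ s → f v₀ + s * f v ≤ r := fun s hs => by
          have := h (v₀ + s • v) fun i => by
            rw [map_add, map_smul, smul_eq_mul]
            have := mul_nonpos_of_nonneg_of_nonpos hs ((hv' i).trans_eq (mul_zero _))
            linarith [hv₀ i]
          simpa using this
        have h0 := h v₀ hv₀
        have := hray ((r - f v₀ + 1) / f v) (div_nonneg (by linarith) hpos.le)
        rw [div_mul_cancel₀ _ hpos.ne'] at this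
        linarith
      · have := h (t⁻¹ • v) fun i => by
          rw [map_smul, smul_eq_mul, inv_mul_le_iff₀ ht, mul_comm]
          exact hv' i
        rw [map_smul, smul_eq_mul, inv_mul_le_iff₀ ht] at this
        linarith)
  refine ⟨fun i => c i.succ, fun i => hc _, fun v => ?_, ?_⟩
  · simpa [A, Fin.sum_univ_succ] using hf (v, 0)
  · have := hf (0, 1)
    simp [A, Fin.sum_univ_succ] at this
    linarith [hc 0]

theorem suppFn_le_iff {Ω : Set X} {xs : X →L[ℝ] ℝ} {r : ℝ} :
    suppFn Ω xs ≤ r ↔ ∀ x ∈ Ω, xs x ≤ r := by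
  simp [suppFn, sSup_le_iff]

theorem le_suppFn {Ω : Set X} (xs : X →L[ℝ] ℝ) {x : X} (hx : x ∈ Ω) :
    ((xs x : ℝ) : EReal) ≤ suppFn Ω xs :=
  le_sSup ⟨x, hx, rfl⟩

theorem suppFn_inter_le_add (Ω1 Ω2 : Set X) (a b : X →L[ℝ] ℝ) :
    suppFn (Ω1 ∩ Ω2) (a + b) ≤ suppFn Ω1 a + suppFn Ω2 b := by
  refine sSup_le ?_
  rintro - ⟨x, hx, rfl⟩
  simpa using add_le_add (le_suppFn a hx.1) (le_suppFn b hx.2)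

theorem suppFn_add_suppFn_le {Ω1 Ω2 : Set X} (h1 : Ω1.Nonempty) (h2 : Ω2.Nonempty)
    {a b : X →L[ℝ] ℝ} {r : ℝ} (h : ∀ x ∈ Ω1, ∀ y ∈ Ω2, a x + b y ≤ r) :
    suppFn Ω1 a + suppFn Ω2 b ≤ r := by
  obtain ⟨x₀, hx₀⟩ := h1
  obtain ⟨y₀, hy₀⟩ := h2
  have hle : ∀ y ∈ Ω2, suppFn Ω1 a ≤ ((r - b y : ℝ) : EReal) := fun y hy =>
    suppFn_le_iff.2 fun x hx => by linarith [h x hx y hy]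
  have hbot : suppFn Ω1 a ≠ ⊥ := ((EReal.bot_lt_coe _).trans_le (le_suppFn a hx₀)).ne'
  have htop : suppFn Ω1 a ≠ ⊤ := ((hle y₀ hy₀).trans_lt (EReal.coe_lt_top _)).ne
  lift suppFn Ω1 a to ℝ using ⟨htop, hbot⟩ with α
  have h2 : suppFn Ω2 b ≤ ((r - α : ℝ) : EReal) :=
    suppFn_le_iff.2 fun y hy => by linarith [EReal.coe_le_coe_iff.1 (hle y hy)]
  calc (α : EReal) + suppFn Ω2 b ≤ α + ((r - α : ℝ) : EReal) := by gcongr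
    _ = r := by rw [← EReal.coe_add, add_sub_cancel]

/-- Decomposition of a functional bounded on an intersection of polyhedral sets. -/
theorem IsPolyhedral.exists_decomposition {Ω1 Ω2 : Set X} (hp1 : IsPolyhedral Ω1)
    (hp2 : IsPolyhedral Ω2) (hne : (Ω1 ∩ Ω2).Nonempty) {xs : X →L[ℝ] ℝ} {r : ℝ}
    (hr : ∀ x ∈ Ω1 ∩ Ω2, xs x ≤ r) :
    ∃ a b : X →L[ℝ] ℝ, a + b = xs ∧ ∀ x ∈ Ω1, ∀ y ∈ Ω2, a x + b y ≤ r := by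
  obtain ⟨m, a, α, rfl⟩ := hp1
  obtain ⟨n, b, β, rfl⟩ := hp2
  have hmem : ∀ v, (∀ i, Fin.append a b i v ≤ Fin.append α β i) ↔
      v ∈ {x | ∀ i, a i x ≤ α i} ∩ {x | ∀ i, b i x ≤ β i} := fun v => by
    simp [Fin.forall_fin_add]
  obtain ⟨v₀, hv₀⟩ := hne
  obtain ⟨c, hc, hf, hcr⟩ := exists_nonneg_sum_smul_of_forall_le
    (fun i => (Fin.append a b i).toLinearMap) (Fin.append α β) xs.toLinearMap r
    ⟨v₀, (hmem v₀).2 hv₀⟩ fun v hv => hr v ((hmem v).1 hv)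
  refine ⟨∑ i, c (Fin.castAdd n i) • a i, ∑ i, c (Fin.natAdd m i) • b i, ?_, ?_⟩
  · ext v
    have := hf v
    simp only [Fin.sum_univ_add, ContinuousLinearMap.coe_coe, Fin.append_left,
      Fin.append_right] at this
    simp [this]
  · intro x hx y hy
    rw [Fin.sum_univ_add] at hcr
    simp only [Fin.append_left, Fin.append_right] at hcr
    refine le_trans (add_le_add ?_ ?_) hcr <;>
      simp only [_root_.sum_apply, _root_.smul_apply, smul_eq_mul]
    · exact Finset.sum_le_sum fun i _ => mul_le_mul_of_nonneg_left (hx i) (hc _)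
    · exact Finset.sum_le_sum fun i _ => mul_le_mul_of_nonneg_left (hy i) (hc _)

/-- Decomposition of a functional bounded on `Ω1 ∩ Ω2`, when near `0` in a subspace containing
`Ω1 - Ω2` every point is a difference `x - y` with the functional bounded below at `x`. -/
theorem exists_decomposition_of_eventually {Ω1 Ω2 : Set X} (hc1 : Convex ℝ Ω1)
    (hc2 : Convex ℝ Ω2) {xs : X →L[ℝ] ℝ} {r : ℝ} (hr : ∀ x ∈ Ω1 ∩ Ω2, xs x ≤ r)
    (S : Submodule ℝ X) (hS : ∀ x ∈ Ω1, ∀ y ∈ Ω2, x - y ∈ S) (M : ℝ)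
    (hM : ∀ᶠ z : S in nhds 0, ∃ x ∈ Ω1, ∃ y ∈ Ω2, x - y = z ∧ M ≤ xs x) :
    ∃ a b : X →L[ℝ] ℝ, a + b = xs ∧ ∀ x ∈ Ω1, ∀ y ∈ Ω2, a x + b y ≤ r := by
  let C : Set (S × ℝ) := {p | ∃ x ∈ Ω1, ∃ y ∈ Ω2, x - y = p.1 ∧ p.2 < xs x - r}
  have hC : Convex ℝ C := by
    rintro ⟨z, t⟩ ⟨x, hx, y, hy, hz, ht⟩ ⟨z', t'⟩ ⟨x', hx', y', hy', hz', ht'⟩ p q hp hq hpq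
    refine ⟨p • x + q • x', hc1 hx hx' hp hq hpq, p • y + q • y', hc2 hy hy' hp hq hpq, ?_, ?_⟩
    · simp only at hz hz'
      simp only [Prod.smul_mk, Prod.mk_add_mk, Submodule.coe_add, Submodule.coe_smul, ← hz, ← hz']
      module
    · simp only [Prod.smul_mk, Prod.mk_add_mk, map_add, map_smul, smul_eq_mul] at ht ht' ⊢
      have hr' : r = p * r + q * r := by rw [← add_mul, hpq, one_mul]
      rcases hp.eq_or_lt with rfl | hp
      · obtain rfl : q = 1 := by linarith
        linarith
      · nlinarith [mul_lt_mul_of_pos_left ht hp, mul_le_mul_of_nonneg_left ht'.le hq]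
  have h0 : (0 : S × ℝ) ∉ C := by
    rintro ⟨x, hx, y, hy, hz, ht⟩
    obtain rfl : x = y := sub_eq_zero.1 (by simpa using hz)
    have := hr x ⟨hx, hy⟩
    simp only [Prod.snd_zero] at ht
    linarith
  have hint : ∀ t < M - r, ((0 : S), t) ∈ interior C := by
    intro t ht
    rw [mem_interior_iff_mem_nhds]
    filter_upwards [prod_mem_nhds hM (Iio_mem_nhds ht)] with p hp
    obtain ⟨x, hx, y, hy, hz, hxM⟩ := hp.1
    exact ⟨x, hx, y, hy, hz, by have := hp.2; simp only [Set.mem_Iio] at this; linarith⟩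
  obtain ⟨f, hf⟩ := geometric_hahn_banach_open_point hC.interior isOpen_interior
    (fun h => h0 (interior_subset h))
  rw [map_zero] at hf
  let g : S →L[ℝ] ℝ := f.comp (ContinuousLinearMap.inl ℝ S ℝ)
  have hfg : ∀ z t, f (z, t) = g z + t * f (0, 1) := fun z t => by
    have : (z, t) = (z, (0 : ℝ)) + t • ((0 : S), (1 : ℝ)) := by simp
    rw [this, map_add, map_smul, smul_eq_mul]
    rfl
  have hpos : 0 < f (0, 1) := by
    have h1 := hf _ (hint (min (M - r) 0 - 1) (by linarith [min_le_left (M - r) 0]))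
    rw [hfg, map_zero, zero_add] at h1
    by_contra! hneg
    have h2 := mul_nonneg_of_nonpos_of_nonpos
      (by linarith [min_le_right (M - r) 0] : min (M - r) 0 - 1 ≤ 0) hneg
    linarith
  have hle : ∀ p ∈ C, f p ≤ 0 := fun p hp => by
    have hp' : p ∈ closure (interior C) := by
      rw [hC.closure_interior_eq_closure_of_nonempty_interior
        ⟨_, hint (M - r - 1) (by linarith)⟩]
      exact subset_closure hp
    exact closure_minimal (fun q hq => (hf q hq).le)
      (isClosed_le f.continuous continuous_const) hp'
  obtain ⟨G, hG, -⟩ := exists_extension_norm_eq S g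
  let b : X →L[ℝ] ℝ := -((f (0, 1))⁻¹ • G)
  refine ⟨xs - b, b, sub_add_cancel _ _, fun x hx y hy => ?_⟩
  have hxy : xs x - r ≤ -((f (0, 1))⁻¹ * G (x - y)) := by
    refine le_of_forall_lt fun t ht => ?_
    obtain ⟨t', ht', htx⟩ := exists_between ht
    have h1 := hle (⟨x - y, hS x hx y hy⟩, t') ⟨x, hx, y, hy, rfl, htx⟩
    rw [hfg, ← hG] at h1
    refine ht'.trans_le ?_
    rw [← mul_neg, le_inv_mul_iff₀ hpos]
    linarith
  simp only [b, map_sub, _root_.sub_apply, _root_.neg_apply,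
    _root_.smul_apply, smul_eq_mul] at hxy ⊢
  linarith

/-- Decomposition of a functional bounded on `Ω1 ∩ Ω2` when `Ω1` meets the interior of `Ω2`. -/
theorem exists_decomposition_of_inter_interior {Ω1 Ω2 : Set X} (hc1 : Convex ℝ Ω1)
    (hc2 : Convex ℝ Ω2) (hne : (Ω1 ∩ interior Ω2).Nonempty) {xs : X →L[ℝ] ℝ} {r : ℝ}
    (hr : ∀ x ∈ Ω1 ∩ Ω2, xs x ≤ r) :
    ∃ a b : X →L[ℝ] ℝ, a + b = xs ∧ ∀ x ∈ Ω1, ∀ y ∈ Ω2, a x + b y ≤ r := by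
  obtain ⟨x₀, hx₀, hx₀'⟩ := hne
  refine exists_decomposition_of_eventually hc1 hc2 hr ⊤ (fun _ _ _ _ => trivial) (xs x₀) ?_
  have hcont : Continuous fun z : (⊤ : Submodule ℝ X) => x₀ - (z : X) := by fun_prop
  have hev : ∀ᶠ z : (⊤ : Submodule ℝ X) in nhds 0, x₀ - (z : X) ∈ Ω2 :=
    hcont.continuousAt.preimage_mem_nhds (by simpa using mem_interior_iff_mem_nhds.1 hx₀')
  filter_upwards [hev] with z hz
  exact ⟨x₀, hx₀, _, hz, sub_sub_cancel _ _, le_rfl⟩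

/-- Decomposition of a functional bounded on `Ω1 ∩ Ω2` under the Attouch–Brezis condition. -/
theorem exists_decomposition_of_zeroSqri [CompleteSpace X] {Ω1 Ω2 : Set X} (hc1 : Convex ℝ Ω1)
    (hc2 : Convex ℝ Ω2) (hcl1 : IsClosed Ω1) (hcl2 : IsClosed Ω2) (hsqri : ZeroSqri (Ω1 - Ω2))
    {xs : X →L[ℝ] ℝ} {r : ℝ} (hr : ∀ x ∈ Ω1 ∩ Ω2, xs x ≤ r) :
    ∃ a b : X →L[ℝ] ℝ, a + b = xs ∧ ∀ x ∈ Ω1, ∀ y ∈ Ω2, a x + b y ≤ r := by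
  obtain ⟨⟨x₀, hx₀, y₀, hy₀, hxy₀⟩, S, hS, hScl⟩ := hsqri
  obtain rfl : x₀ = y₀ := sub_eq_zero.1 hxy₀
  have hsub : ∀ x ∈ Ω1, ∀ y ∈ Ω2, x - y ∈ S := fun x hx y hy => by
    rw [← SetLike.mem_coe, hS]
    exact ⟨1, zero_le_one, x - y, Set.sub_mem_sub hx hy, (one_smul ℝ _).symm⟩
  let D : X × X →L[ℝ] X := ContinuousLinearMap.fst ℝ X X - ContinuousLinearMap.snd ℝ X X
  let T : Submodule ℝ (X × X) := S.comap D.toLinearMap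
  have : CompleteSpace S := hScl.completeSpace_coe
  have hTcl : IsClosed (T : Set (X × X)) := hScl.preimage D.continuous
  have : CompleteSpace T := hTcl.completeSpace_coe
  let L : T →L[ℝ] S := (D.comp T.subtypeL).codRestrict S fun p => p.2
  let K : Set T := T.subtypeL ⁻¹' ((Ω1 ∩ Metric.closedBall x₀ 1) ×ˢ (Ω2 ∩ Metric.closedBall x₀ 1))
  have hKcl : IsClosed K := ((hcl1.inter Metric.isClosed_closedBall).prod
    (hcl2.inter Metric.isClosed_closedBall)).preimage T.subtypeL.continuous
  have hKcv : Convex ℝ K := ((hc1.inter (convex_closedBall _ _)).prod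
    (hc2.inter (convex_closedBall _ _))).linear_preimage T.subtypeL.toLinearMap
  have hball : ∀ x ∈ Metric.closedBall x₀ 1, ‖x‖ ≤ ‖x₀‖ + 1 := fun x hx => by
    have := norm_le_norm_add_norm_sub' x x₀
    rw [mem_closedBall_iff_norm] at hx
    linarith
  have hKbd : ∀ k ∈ K, ‖k‖ ≤ ‖x₀‖ + 1 := fun k hk =>
    max_le (hball _ hk.1.2) (hball _ hk.2.2)
  have habs : ∀ s : S, ∃ t : ℝ, 0 < t ∧ t • s ∈ L '' K := by
    intro s
    have hs : (s : X) ∈ coneGen (Ω1 - Ω2) := hS ▸ s.2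
    obtain ⟨t, ht, -, ⟨x, hx, y, hy, rfl⟩, hst⟩ := hs
    have hnx := norm_nonneg (x - x₀)
    have hny := norm_nonneg (y - x₀)
    have htx := mul_nonneg ht hnx
    have hty := mul_nonneg ht hny
    let τ : ℝ := (1 + t + t * ‖x - x₀‖ + t * ‖y - x₀‖)⁻¹
    have hτ : 0 < τ := by positivity
    have hscale : ∀ q ≤ 1 + t + t * ‖x - x₀‖ + t * ‖y - x₀‖, τ * q ≤ 1 := fun q hq => by
      rw [inv_mul_le_iff₀ (by positivity), mul_one]
      exact hq
    have hε0 : 0 ≤ τ * t := by positivity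
    have hε1 : τ * t ≤ 1 := hscale t (by linarith)
    have hεx : x₀ + (τ * t) • (x - x₀) ∈ Metric.closedBall x₀ 1 := by
      rw [mem_closedBall_iff_norm, add_sub_cancel_left, norm_smul, Real.norm_of_nonneg hε0,
        mul_assoc]
      exact hscale _ (by linarith)
    have hεy : x₀ + (τ * t) • (y - x₀) ∈ Metric.closedBall x₀ 1 := by
      rw [mem_closedBall_iff_norm, add_sub_cancel_left, norm_smul, Real.norm_of_nonneg hε0,
        mul_assoc]
      exact hscale _ (by linarith)
    have hx' := hc1.add_smul_sub_mem hx₀ hx ⟨hε0, hε1⟩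
    have hy' := hc2.add_smul_sub_mem hy₀ hy ⟨hε0, hε1⟩
    refine ⟨τ, hτ, ⟨(x₀ + (τ * t) • (x - x₀), x₀ + (τ * t) • (y - x₀)), hsub _ hx' _ hy'⟩,
      ⟨⟨hx', hεx⟩, ⟨hy', hεy⟩⟩, Subtype.ext ?_⟩
    change x₀ + (τ * t) • (x - x₀) - (x₀ + (τ * t) • (y - x₀)) = τ • (s : X)
    rw [hst]
    simp only
    module
  refine exists_decomposition_of_eventually hc1 hc2 hr S hsub (-(‖xs‖ * (‖x₀‖ + 1))) ?_
  filter_upwards [image_mem_nhds_zero_of_forall_exists_smul_mem L hKcl hKcv hKbd habs]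
  rintro - ⟨k, hk, rfl⟩
  refine ⟨k.1.1, hk.1.1, k.1.2, hk.2.1, rfl, ?_⟩
  have h1 := (abs_le.1 (xs.le_opNorm k.1.1)).1
  have h2 : ‖xs‖ * ‖k.1.1‖ ≤ ‖xs‖ * (‖x₀‖ + 1) :=
    mul_le_mul_of_nonneg_left (hball _ hk.1.2) (norm_nonneg xs)
  linarith

/-- Support function intersection rule under (a) interiority, (b) polyhedrality, or
(c) the Attouch–Brezis condition in Banach spaces; with exactness of the infimal
convolution wherever `σ_{Ω₁∩Ω₂}` is finite. -/
theorem support_intersection_rule (Ω1 Ω2 : Set X)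
    (h1 : Ω1.Nonempty) (h2 : Ω2.Nonempty) (hc1 : Convex ℝ Ω1) (hc2 : Convex ℝ Ω2)
    (hqc : (Ω1 ∩ interior Ω2).Nonempty ∨
      (IsPolyhedral Ω1 ∧ IsPolyhedral Ω2 ∧ (Ω1 ∩ Ω2).Nonempty) ∨
      (CompleteSpace X ∧ IsClosed Ω1 ∧ IsClosed Ω2 ∧ ZeroSqri (Ω1 - Ω2))) :
    (∀ xs : X →L[ℝ] ℝ,
      suppFn (Ω1 ∩ Ω2) xs =
        sInf {z : EReal | ∃ a b : X →L[ℝ] ℝ, a + b = xs ∧ z = suppFn Ω1 a + suppFn Ω2 b}) ∧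
    (∀ (xs : X →L[ℝ] ℝ) (r : ℝ), suppFn (Ω1 ∩ Ω2) xs = (r : EReal) →
      ∃ a b : X →L[ℝ] ℝ, a + b = xs ∧
        suppFn (Ω1 ∩ Ω2) xs = suppFn Ω1 a + suppFn Ω2 b) := by
  have hne : (Ω1 ∩ Ω2).Nonempty := by
    rcases hqc with h | ⟨-, -, h⟩ | ⟨-, -, -, ⟨x, hx, y, hy, hxy⟩, -⟩
    · exact h.mono (Set.inter_subset_inter_right _ interior_subset)
    · exact h
    · obtain rfl : x = y := sub_eq_zero.1 hxy
      exact ⟨x, hx, hy⟩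
  have hexact : ∀ (xs : X →L[ℝ] ℝ) (r : ℝ), suppFn (Ω1 ∩ Ω2) xs = (r : EReal) →
      ∃ a b : X →L[ℝ] ℝ, a + b = xs ∧
        suppFn (Ω1 ∩ Ω2) xs = suppFn Ω1 a + suppFn Ω2 b := by
    intro xs r hxs
    have hr : ∀ x ∈ Ω1 ∩ Ω2, xs x ≤ r := suppFn_le_iff.1 hxs.le
    obtain ⟨a, b, rfl, hab⟩ :
        ∃ a b : X →L[ℝ] ℝ, a + b = xs ∧ ∀ x ∈ Ω1, ∀ y ∈ Ω2, a x + b y ≤ r := by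
      rcases hqc with h | ⟨hp1, hp2, h⟩ | ⟨hX, hcl1, hcl2, h⟩
      · exact exists_decomposition_of_inter_interior hc1 hc2 h hr
      · exact hp1.exists_decomposition hp2 h hr
      · exact exists_decomposition_of_zeroSqri hc1 hc2 hcl1 hcl2 h hr
    refine ⟨a, b, rfl, (suppFn_inter_le_add Ω1 Ω2 a b).antisymm ?_⟩
    rw [hxs]
    exact suppFn_add_suppFn_le h1 h2 hab
  refine ⟨fun xs => le_antisymm (le_sInf ?_) ?_, hexact⟩
  · rintro - ⟨a, b, rfl, rfl⟩
    exact suppFn_inter_le_add Ω1 Ω2 a b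
  · by_cases htop : suppFn (Ω1 ∩ Ω2) xs = ⊤
    · exact htop ▸ le_top
    obtain ⟨x, hx⟩ := hne
    have hbot : suppFn (Ω1 ∩ Ω2) xs ≠ ⊥ :=
      ((EReal.bot_lt_coe _).trans_le (le_suppFn xs hx)).ne'
    obtain ⟨a, b, hab, h⟩ := hexact xs _ (EReal.coe_toReal htop hbot).symm
    exact sInf_le ⟨a, b, hab, h⟩

end
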